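/- Let C = C_{t₁} ⊕ C_{t₂} ⊕ ⋯ ⊕ C_{t_U} be a quasi-cyclic code of length lm and index l over F_q, where 0 ≤ t₁ < t₂ < ⋯ < t_U ≤ s, each C_{t_j} is a linear code over R_m ε_{t_j} of length l which, as an F_q-code, is an [lm, K_{t_j}] quasi-cyclic code, and the primitive idempotent ε_{t_j} corresponds to the q-cyclotomic coset {i_{t_j}, i_{t_j}q, …, i_{t_j}q^{k_{t_j}−1}} modulo m. Fix a nonempty subset {j₁ < j₂ < ⋯ < j_u} of {1, 2, …, U} and let C^♯ = {c_{t_{j₁}} + ⋯ + c_{t_{j_u}} : c_{t_{j_v}} ∈ C_{t_{j_v}} \ {0} for all 1 ≤ v ≤ u}. Then for each positive divisor r of m, the number of elements c ∈ C^♯ with ρ^{rl}(c) = c is equal to ∏_{v=1}^{u} (q^{K_{t_{j_v}}} − 1) if (m/r) divides i_{t_{j_v}} for all v = 1, …, u, and is equal to 0 otherwise. -/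

import Mathlib

/-- The shift `ρ^l` on `F^{lm}`, with a codeword indexed as `c (i, j) = c_{ij}`
(`i ∈ ZMod m` the block index, `j ∈ Fin l` the position inside a block):
`(ρ^l c) (i, j) = c (i - 1, j)`. -/
noncomputable def shiftQC (F : Type*) [Field F] (m l : ℕ) :
    ((ZMod m × Fin l) → F) ≃ₗ[F] ((ZMod m × Fin l) → F) :=
  LinearEquiv.funCongrLeft F F ((Equiv.subRight (1 : ZMod m)).prodCongr (Equiv.refl (Fin l)))

/-- The `q`-cyclotomic coset of `i_t` modulo `m`, viewed inside `ZMod m`. -/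
def cycCoset (q m it : ℕ) : Set (ZMod m) :=
  {j | ∃ r : ℕ, j = (it : ZMod m) * (q : ZMod m) ^ r}

/-- Evaluation of the polynomial `Σ_i c_i x^i ∈ R_m = F[x]/(x^m - 1)` at `ζ^j`, computed in
an extension field `E` of `F` containing the primitive `m`-th root of unity `ζ`. -/
noncomputable def evalDFT {F E : Type*} [Field F] [Field E] [Algebra F E] {m : ℕ} [NeZero m]
    (ζ : E) (c : ZMod m → F) (j : ZMod m) : E :=
  ∑ i : ZMod m, algebraMap F E (c i) * ζ ^ (i * j).val

/-- `Σ_i c_i x^i` lies in the minimal ideal `R_m ε_t` of `R_m` associated with the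
`q`-cyclotomic coset of `i_t`, i.e. it vanishes at `ζ^j` for every `j` outside the coset. -/
def inMinIdeal {F E : Type*} [Field F] [Field E] [Algebra F E] (q : ℕ) {m : ℕ} [NeZero m]
    (ζ : E) (it : ℕ) (c : ZMod m → F) : Prop :=
  ∀ j : ZMod m, j ∉ cycCoset q m it → evalDFT ζ c j = 0

lemma pow_val_add {M : Type*} [Monoid M] {m : ℕ} [NeZero m] {ζ : M} (hζ : ζ ^ m = 1)
    (a b : ZMod m) : ζ ^ (a + b).val = ζ ^ a.val * ζ ^ b.val := by
  rw [ZMod.val_add, ← pow_add, ← pow_eq_pow_mod _ hζ]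

lemma shiftQC_pow_apply {F : Type*} [Field F] {m l : ℕ} (r : ℕ)
    (c : (ZMod m × Fin l) → F) (i : ZMod m) (v : Fin l) :
    (shiftQC F m l ^ r) c (i, v) = c (i - r, v) := by
  induction r generalizing i with
  | zero => simp
  | succ r ih =>
    rw [pow_succ', LinearEquiv.mul_apply]
    change (shiftQC F m l ^ r) c (i - 1, v) = _
    rw [ih]
    push_cast
    congr 2
    ring

lemma shiftQC_pow_mem {F : Type*} [Field F] {m l : ℕ}
    {C : Submodule F ((ZMod m × Fin l) → F)} (hC : ∀ c ∈ C, shiftQC F m l c ∈ C) (r : ℕ)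
    {c : (ZMod m × Fin l) → F} (hc : c ∈ C) : (shiftQC F m l ^ r) c ∈ C := by
  induction r with
  | zero => simpa
  | succ r ih =>
    rw [pow_succ', LinearEquiv.mul_apply]
    exact hC _ ih

section DFT

variable {F E : Type*} [Field F] [Field E] [Algebra F E] {m : ℕ} [NeZero m] {ζ : E}

lemma evalDFT_sub (c d : ZMod m → F) (j : ZMod m) :
    evalDFT ζ (c - d) j = evalDFT ζ c j - evalDFT ζ d j := by
  simp [evalDFT, sub_mul]

lemma evalDFT_sum {ι : Type*} (s : Finset ι) (c : ι → ZMod m → F) (j : ZMod m) :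
    evalDFT ζ (∑ v ∈ s, c v) j = ∑ v ∈ s, evalDFT ζ (c v) j := by
  simp only [evalDFT, Finset.sum_apply, map_sum, Finset.sum_mul]
  exact Finset.sum_comm

lemma evalDFT_translate (hζ : ζ ^ m = 1) (c : ZMod m → F) (a j : ZMod m) :
    evalDFT ζ (fun i => c (i - a)) j = ζ ^ (a * j).val * evalDFT ζ c j := by
  rw [evalDFT, evalDFT, Finset.mul_sum, ← Equiv.sum_comp (Equiv.addRight a)]
  refine Finset.sum_congr rfl fun i _ => ?_
  simp only [Equiv.coe_addRight, add_sub_cancel_right, add_mul, pow_val_add hζ]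
  ring

lemma eq_zero_of_evalDFT_eq_zero (hζ : IsPrimitiveRoot ζ m) {c : ZMod m → F}
    (h : ∀ j, evalDFT ζ c j = 0) : c = 0 := by
  obtain _ | n := m
  · exact (NeZero.ne 0 rfl).elim
  have hinj : Function.Injective fun j : Fin (n + 1) => ζ ^ (j : ℕ) :=
    fun a b hab => Fin.ext (hζ.pow_inj a.2 b.2 hab)
  have hv := Matrix.eq_zero_of_forall_index_sum_pow_mul_eq_zero
    (v := fun i : Fin (n + 1) => algebraMap F E (c i)) hinj fun j => by
      rw [← h j]
      refine Finset.sum_congr rfl fun i _ => ?_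
      rw [mul_comm, ← pow_mul]
      congr 1
      rw [mul_comm, pow_eq_pow_mod _ hζ.pow_eq_one]
      exact congrArg (ζ ^ ·) (ZMod.val_mul (n := n + 1) i j).symm
  funext i
  exact (map_eq_zero (algebraMap F E)).mp (congrFun hv i)

lemma eq_of_evalDFT_eq {l : ℕ} (hζ : IsPrimitiveRoot ζ m) {c d : (ZMod m × Fin l) → F}
    (h : ∀ v j, evalDFT ζ (fun i => c (i, v)) j = evalDFT ζ (fun i => d (i, v)) j) :
    c = d := by
  funext ⟨i, v⟩
  have := eq_zero_of_evalDFT_eq_zero hζ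
    (c := (fun i => c (i, v)) - fun i => d (i, v))
    fun j => by rw [evalDFT_sub, h, sub_self]
  exact sub_eq_zero.mp (congrFun this i)

lemma cycCoset_eq_of_mem {q it : ℕ} (hco : m.Coprime q) {j : ZMod m}
    (hj : j ∈ cycCoset q m it) :
    cycCoset q m it = {k | ∃ s : ℕ, k = j * (q : ZMod m) ^ s} := by
  obtain ⟨a, rfl⟩ := hj
  obtain ⟨n, hn, h1⟩ : ∃ n, 0 < n ∧ (q : ZMod m) ^ n = 1 := by
    refine ⟨m.totient, Nat.totient_pos.mpr (NeZero.pos m), ?_⟩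
    have := ZMod.pow_totient (ZMod.unitOfCoprime q hco.symm)
    exact (congrArg Units.val this :)
  ext k
  constructor
  · rintro ⟨b, rfl⟩
    refine ⟨(n - 1) * a + b, ?_⟩
    have : a + ((n - 1) * a + b) = n * a + b := by
      obtain ⟨n, rfl⟩ := Nat.exists_eq_succ_of_ne_zero hn.ne'
      simp only [Nat.succ_eq_add_one, Nat.add_sub_cancel]
      ring
    rw [mul_assoc, ← pow_add, this, pow_add, pow_mul, h1, one_pow, one_mul]
  · rintro ⟨b, rfl⟩
    exact ⟨a + b, by rw [mul_assoc, ← pow_add]⟩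

lemma shiftQC_pow_eq_self_iff {l q r it : ℕ} (hζ : IsPrimitiveRoot ζ m)
    (hco : m.Coprime q) (hr : r ∣ m) (hrpos : 0 < r) {c : (ZMod m × Fin l) → F} (hc : c ≠ 0)
    (hmin : ∀ v : Fin l, inMinIdeal q ζ it (fun i : ZMod m => c (i, v))) :
    (shiftQC F m l ^ r) c = c ↔ m / r ∣ it := by
  have hdvd : m / r ∣ it ↔ (r : ZMod m) * it = 0 := by
    rw [Nat.div_dvd_iff_dvd_mul hr hrpos, ← Nat.cast_mul, ZMod.natCast_eq_zero_iff]
  have hshift (v : Fin l) (j : ZMod m) :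
      evalDFT ζ (fun i => (shiftQC F m l ^ r) c (i, v)) j =
        ζ ^ ((r : ZMod m) * j).val * evalDFT ζ (fun i => c (i, v)) j := by
    simp only [shiftQC_pow_apply]
    exact evalDFT_translate hζ.pow_eq_one (fun i => c (i, v)) r j
  rw [hdvd]
  constructor
  · intro h
    obtain ⟨v, j, hj⟩ : ∃ v j, evalDFT ζ (fun i => c (i, v)) j ≠ 0 := by
      by_contra! h0
      exact hc (eq_of_evalDFT_eq hζ fun v j => by rw [h0]; simp [evalDFT])
    have h1 := hshift v j
    rw [h, right_eq_mul₀ hj, hζ.pow_eq_one_iff_dvd] at h1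
    have h2 : (r : ZMod m) * j = 0 :=
      (ZMod.val_eq_zero _).mp (Nat.eq_zero_of_dvd_of_lt h1 (ZMod.val_lt _))
    obtain ⟨a, rfl⟩ := not_imp_comm.mp (hmin v j) hj
    rw [← mul_assoc] at h2
    exact ((((ZMod.unitOfCoprime q hco.symm).isUnit).pow a).mul_left_eq_zero).mp h2
  · intro h
    refine eq_of_evalDFT_eq hζ fun v j => ?_
    rw [hshift]
    by_cases hj : j ∈ cycCoset q m it
    · obtain ⟨a, rfl⟩ := hj
      simp [← mul_assoc, h]
    · simp [hmin v j hj]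

lemma eq_of_sum_eq_of_inMinIdeal {l q : ℕ} {ι : Type*} [Fintype ι] {it : ι → ℕ}
    (hζ : IsPrimitiveRoot ζ m) (hco : m.Coprime q)
    (hdist : ∀ j j', j ≠ j' → cycCoset q m (it j) ≠ cycCoset q m (it j'))
    {f g : ι → (ZMod m × Fin l) → F}
    (hf : ∀ k v, inMinIdeal q ζ (it k) (fun i : ZMod m => f k (i, v)))
    (hg : ∀ k v, inMinIdeal q ζ (it k) (fun i : ZMod m => g k (i, v)))
    (h : ∑ k, f k = ∑ k, g k) : f = g := by
  funext k
  refine eq_of_evalDFT_eq hζ fun v j => ?_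
  by_cases hj : j ∈ cycCoset q m (it k)
  · have key (f : ι → (ZMod m × Fin l) → F)
        (hf : ∀ k v, inMinIdeal q ζ (it k) (fun i : ZMod m => f k (i, v))) :
        evalDFT ζ (fun i => (∑ k, f k) (i, v)) j = evalDFT ζ (fun i => f k (i, v)) j := by
      have hsum : (fun i => (∑ k, f k) (i, v)) = ∑ k, fun i => f k (i, v) := by
        funext i
        simp
      rw [hsum, evalDFT_sum]
      refine Finset.sum_eq_single k (fun k' _ hk' => hf k' v j fun hj' => ?_) (by simp)
      exact hdist k' k hk' <| by rw [cycCoset_eq_of_mem hco hj, cycCoset_eq_of_mem hco hj']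
    rw [← key f hf, ← key g hg, h]
  · rw [hf k v j hj, hg k v j hj]

end DFT

lemma Submodule.natCard_ne_zero {F V : Type*} [Field F] [Fintype F] [AddCommGroup V]
    [Module F V] [Finite V] (C : Submodule F V) :
    Nat.card {x : C // x ≠ 0} = Fintype.card F ^ Module.finrank F C - 1 := by
  classical
  have := Fintype.ofFinite C
  rw [Nat.card_eq_fintype_card, Fintype.card_subtype_compl, Fintype.card_subtype_eq,
    Module.card_eq_pow_finrank (K := F)]

/-- Let `C = C_{t₁} ⊕ ⋯ ⊕ C_{t_U}` be a quasi-cyclic code of length `lm`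
and index `l` over `F_q`, each `C_{t_j}` an `[lm, K_{t_j}]` linear code over the minimal
ideal `R_m ε_{t_j}` (distinct cyclotomic cosets).  For a nonempty subset
`{j₁ < ⋯ < j_u} ⊆ {1, …, U}`, let `C^♯` be the set of sums of nonzero codewords, one from
each chosen component.  Then for every positive divisor `r` of `m`, the number of `c ∈ C^♯`
with `ρ^{rl} c = c` is `∏_v (q^{K_{t_{j_v}}} - 1)` if `(m/r) ∣ i_{t_{j_v}}` for all `v`, and
`0` otherwise. -/
theorem fixed_points_shift_direct_sum {F E : Type*} [Field F] [Fintype F] [DecidableEq F]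
    [Field E] [Algebra F E] {m l U u : ℕ} [NeZero m] (hl : 2 ≤ l)
    (hco : Nat.Coprime m (Fintype.card F))
    (ζ : E) (hζ : IsPrimitiveRoot ζ m)
    (it K : Fin U → ℕ)
    (Ct : Fin U → Submodule F ((ZMod m × Fin l) → F))
    (hQC : ∀ j, ∀ c ∈ Ct j, shiftQC F m l c ∈ Ct j)
    (hmin : ∀ j, ∀ c ∈ Ct j, ∀ v : Fin l,
      inMinIdeal (Fintype.card F) ζ (it j) (fun i : ZMod m => c (i, v)))
    (hK : ∀ j, Module.finrank F ↥(Ct j) = K j)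
    (hdist : ∀ j j' : Fin U, j ≠ j' →
      cycCoset (Fintype.card F) m (it j) ≠ cycCoset (Fintype.card F) m (it j'))
    (t : Fin u → Fin U) (ht : StrictMono t) (hu : 0 < u)
    {r : ℕ} (hr : r ∣ m) (hrpos : 0 < r) :
    Set.ncard {c : (ZMod m × Fin l) → F |
        (∃ f : Fin u → ((ZMod m × Fin l) → F),
          (∀ v : Fin u, f v ∈ Ct (t v) ∧ f v ≠ 0) ∧ c = ∑ v : Fin u, f v) ∧
        (shiftQC F m l ^ r) c = c} =
      if ∀ v : Fin u, (m / r) ∣ it (t v) then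
        ∏ v : Fin u, (Fintype.card F ^ K (t v) - 1)
      else 0 := by
  have hindep {f g : Fin u → (ZMod m × Fin l) → F} (hf : ∀ v, f v ∈ Ct (t v))
      (hg : ∀ v, g v ∈ Ct (t v)) (h : ∑ v, f v = ∑ v, g v) : f = g :=
    eq_of_sum_eq_of_inMinIdeal (it := fun v => it (t v)) hζ hco
      (fun v v' hv => hdist _ _ (ht.injective.ne hv))
      (fun v => hmin _ _ (hf v)) (fun v => hmin _ _ (hg v)) h
  have hfixed {f : Fin u → (ZMod m × Fin l) → F} (hf : ∀ v, f v ∈ Ct (t v) ∧ f v ≠ 0) :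
      (shiftQC F m l ^ r) (∑ v, f v) = ∑ v, f v ↔ ∀ v, m / r ∣ it (t v) := by
    have hiff v := shiftQC_pow_eq_self_iff hζ hco hr hrpos (hf v).2 (hmin _ _ (hf v).1)
    rw [map_sum]
    refine ⟨fun h v => (hiff v).mp ?_, fun h => Finset.sum_congr rfl fun v _ => (hiff v).mpr (h v)⟩
    exact congrFun (hindep (fun v => shiftQC_pow_mem (hQC _) r (hf v).1) (fun v => (hf v).1) h) v
  split_ifs with hall
  · let S : (∀ v, {x : Ct (t v) // x ≠ 0}) → (ZMod m × Fin l) → F := fun f => ∑ v, (f v : _)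
    have hS : Function.Injective S := fun f g h => by
      have := hindep (fun v => (f v).1.2) (fun v => (g v).1.2) h
      funext v
      exact Subtype.ext (Subtype.ext (congrFun this v))
    have hrange : {c : (ZMod m × Fin l) → F |
        (∃ f : Fin u → ((ZMod m × Fin l) → F),
          (∀ v : Fin u, f v ∈ Ct (t v) ∧ f v ≠ 0) ∧ c = ∑ v : Fin u, f v) ∧
        (shiftQC F m l ^ r) c = c} = Set.range S := by
      ext c
      constructor
      · rintro ⟨⟨f, hf, rfl⟩, -⟩
        exact ⟨fun v => ⟨⟨f v, (hf v).1⟩, fun h => (hf v).2 (congrArg Subtype.val h)⟩, rfl⟩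
      · rintro ⟨f, rfl⟩
        have hf v : ((f v).1 : (ZMod m × Fin l) → F) ∈ Ct (t v) ∧
            ((f v).1 : (ZMod m × Fin l) → F) ≠ 0 :=
          ⟨(f v).1.2, fun h => (f v).2 (Subtype.ext h)⟩
        exact ⟨⟨_, hf, rfl⟩, (hfixed hf).mpr hall⟩
    rw [hrange, ← Nat.card_coe_set_eq, Nat.card_range_of_injective hS, Nat.card_pi]
    exact Finset.prod_congr rfl fun v _ => by rw [Submodule.natCard_ne_zero, hK]
  · refine Set.ncard_eq_zero (Set.toFinite _) |>.mpr (Set.eq_empty_of_forall_notMem ?_)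
    rintro _ ⟨⟨f, hf, rfl⟩, h⟩
    exact hall ((hfixed hf).mp h)
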